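/- arXiv:math/0111109 — 2 statements merged into one kernel-verified Lean document; each statement's English description precedes it below -/
import Mathlib

section
/- Let g : ℝⁿ → ℝⁿ be a bounded, Lipschitz continuous vector field with Lipschitz constant L, let x₀ ∈ ℝⁿ, and let w be a left-continuous function of bounded variation on [0, ∞). Let x be the solution of ẋ = g(x) with x(0) = x₀, and let y satisfy y(t) = x₀ + ∫₀ᵗ g(y(s)) ds + (w(t) − w(0)) for all t ≥ 0. Then for every t ≥ 0, |y(t) − x(t)| ≤ e^{Lt} · Tot.Var.{w}. -/
open Set Filter MeasureTheory Metric
open scoped Topology RealInnerProductSpace ENNReal NNReal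

noncomputable section

/-- The plane `ℝ²`. -/
abbrev E2 : Type := EuclideanSpace ℝ (Fin 2)

/-- Total variation of `w` on the set `s`, as a real number. -/
def totVar {E : Type*} [PseudoEMetricSpace E] (w : ℝ → E) (s : Set ℝ) : ℝ :=
  (eVariationOn w s).toReal

/-- `w` is left continuous. -/
def LeftCont {E : Type*} [TopologicalSpace E] (w : ℝ → E) : Prop :=
  ∀ t : ℝ, Tendsto w (𝓝[<] t) (𝓝 (w t))

/-- `y` is a (measurable) solution of the impulsive equation `ẏ = g(y) + ẇ` on `[t₀, t₁]`,
in the integral sense `y(t) = y(t₀) + ∫_{t₀}^t g(y(s)) ds + (w(t) - w(t₀))`. -/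
structure IsImpulsiveSol {E : Type*} [NormedAddCommGroup E] [NormedSpace ℝ E]
    [MeasurableSpace E] (g : E → E) (w y : ℝ → E) (t₀ t₁ : ℝ) : Prop where
  meas : Measurable y
  integrable : ∀ t ∈ Icc t₀ t₁, IntervalIntegrable (fun s => g (y s)) volume t₀ t
  eqn : ∀ t ∈ Icc t₀ t₁, y t = y t₀ + (∫ s in t₀..t, g (y s)) + (w t - w t₀)

/-- `x` is a Carathéodory solution of `ẋ = g(x)` on `[t₀, t₁]`. -/
structure IsCaratheodorySol {E : Type*} [NormedAddCommGroup E] [NormedSpace ℝ E]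
    (g : E → E) (x : ℝ → E) (t₀ t₁ : ℝ) : Prop where
  integrable : ∀ t ∈ Icc t₀ t₁, IntervalIntegrable (fun s => g (x s)) volume t₀ t
  eqn : ∀ t ∈ Icc t₀ t₁, x t = x t₀ + ∫ s in t₀..t, g (x s)

/-- The tangent cone of the paper: `T_Ω(x) = {v : liminf_{t↓0} d(x+tv, Ω)/t = 0}`. -/
def paperTangentCone {E : Type*} [NormedAddCommGroup E] [NormedSpace ℝ E]
    (Ω : Set E) (x : E) : Set E :=
  {v | Filter.liminf (fun t : ℝ => infDist (x + t • v) Ω / t) (𝓝[>] 0) = 0}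

/-- A patchy vector field on the open domain `dom`, with patches `(Ωp α, gp α)`
indexed by a totally ordered set `ι`. -/
structure PatchyVF (E : Type*) [NormedAddCommGroup E] [NormedSpace ℝ E]
    (ι : Type*) [LinearOrder ι] where
  dom : Set E
  Ωp : ι → Set E
  gp : ι → E → E
  g : E → E
  dom_open : IsOpen dom
  patch_open : ∀ α, IsOpen (Ωp α)
  patch_smooth : ∀ α, ∃ U : Set E, IsOpen U ∧ closure (Ωp α) ⊆ U ∧
    ContDiffOn ℝ (⊤ : ℕ∞) (gp α) U
  inward : ∀ α, ∀ x ∈ frontier (Ωp α),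
    gp α x ∈ interior (paperTangentCone (Ωp α) x)
  cover : dom = ⋃ α, Ωp α
  loc_fin : ∀ K : Set E, IsCompact K → {α | (Ωp α ∩ K).Nonempty}.Finite
  compat : ∀ α, ∀ x ∈ Ωp α \ (⋃ β > α, Ωp β), g x = gp α x

/-- `D_α = Ω_α \ ⋃_{β>α} Ω_β`. -/
def PatchyVF.D {E : Type*} [NormedAddCommGroup E] [NormedSpace ℝ E]
    {ι : Type*} [LinearOrder ι] (P : PatchyVF E ι) (α : ι) : Set E :=
  P.Ωp α \ (⋃ β > α, P.Ωp β)

/-- The line `{x : ⟪x, n⟫ = c}` in the plane. -/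
def lineNC (n : E2) (c : ℝ) : Set E2 := {x : E2 | ⟪x, n⟫ = c}

/-- An open polygon: an open set whose boundary is contained in finitely many lines. -/
def IsPolygon (S : Set E2) : Prop :=
  ∃ L : Finset (E2 × ℝ), (∀ p ∈ L, p.1 ≠ 0) ∧ frontier S ⊆ ⋃ p ∈ L, lineNC p.1 p.2

/-- `e` is an edge of (the boundary of) `S`: a maximal nondegenerate segment
contained in `frontier S`. -/
def IsEdgeOf (e S : Set E2) : Prop :=
  (∃ a b : E2, a ≠ b ∧ e = segment ℝ a b) ∧ e ⊆ frontier S ∧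
    ∀ a' b' : E2, e ⊆ segment ℝ a' b' → segment ℝ a' b' ⊆ frontier S →
      segment ℝ a' b' = e

/-- The set of edges of `S`. -/
def edgeSet (S : Set E2) : Set (Set E2) := {e | IsEdgeOf e S}

/-- The line `{⟪·,n⟫ = c}` contains an edge of `S`. -/
def ContainsEdgeOf (n : E2) (c : ℝ) (S : Set E2) : Prop :=
  ∃ e : Set E2, IsEdgeOf e S ∧ e ⊆ lineNC n c

/-- `v` is a vertex of `S`: a common point of two distinct edges. -/
def IsVertexOf (v : E2) (S : Set E2) : Prop :=
  ∃ e₁ e₂ : Set E2, IsEdgeOf e₁ S ∧ IsEdgeOf e₂ S ∧ e₁ ≠ e₂ ∧ v ∈ e₁ ∩ e₂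

/-- A family of points (indexed by `idx`) lies on pairwise different edges of `S`. -/
def OnDifferentEdges {β : Type*} (S : Set E2) (pts : β → E2) (idx : Set β) : Prop :=
  ∃ e : β → Set E2, (∀ i ∈ idx, IsEdgeOf (e i) S ∧ pts i ∈ e i) ∧ InjOn e idx

/-- A polygonal patchy vector field on the plane. -/
structure PolygonalPVF (ι : Type*) [LinearOrder ι] extends PatchyVF E2 ι where
  polygonal : ∀ α, IsPolygon (Ωp α)

namespace PolygonalPVF

variable {ι : Type*} [LinearOrder ι]

abbrev D (P : PolygonalPVF ι) (α : ι) : Set E2 := P.toPatchyVF.D α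

/-- Condition (C): every `g_α` is transversal, on `closure (D_α)`, to every line
containing an edge of a higher-indexed patch. -/
def ConditionC (P : PolygonalPVF ι) : Prop :=
  ∀ α γ : ι, α < γ → ∀ (n : E2) (c : ℝ), n ≠ 0 →
    ContainsEdgeOf n c (P.Ωp γ) →
    ∀ x ∈ lineNC n c ∩ closure (P.D α), ⟪P.gp α x, n⟫ ≠ 0

/-- The values of `g` are (uniformly) bounded away from zero. -/
def UnifNonzero (P : PolygonalPVF ι) : Prop :=
  ∃ c > 0, ∀ x ∈ P.dom, c ≤ ‖P.g x‖

/-- `X` is a classical solution of `ẋ = g_α(x)` on `I`. -/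
def TrajOn (P : PolygonalPVF ι) (α : ι) (X : ℝ → E2) (I : Set ℝ) : Prop :=
  ∀ t ∈ I, HasDerivAt X (P.gp α (X t)) t

/-- `s` is the first (positive) time at which `X` reaches `closure Ω_α \ D_α`;
i.e. `s = t_α⁺(X 0)`. -/
def ForwardExit (P : PolygonalPVF ι) (α : ι) (X : ℝ → E2) (s : ℝ) : Prop :=
  0 < s ∧ (∀ t ∈ Ioo (0:ℝ) s, X t ∈ P.D α) ∧ X s ∈ closure (P.Ωp α) \ P.D α

/-- Incoming boundary points of `D_α` (points with `t_α⁺ > 0`). -/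
def incomingBdry (P : PolygonalPVF ι) (α : ι) : Set E2 :=
  {x | x ∈ frontier (P.D α) ∧ ∃ (X : ℝ → E2) (δ : ℝ), 0 < δ ∧ X 0 = x ∧
    TrajOn P α X (Icc 0 δ) ∧ ∀ t ∈ Ioo (0:ℝ) δ, X t ∈ P.D α}

/-- Outgoing boundary points of `D_α` (points with `t_α⁻ < 0`). -/
def outgoingBdry (P : PolygonalPVF ι) (α : ι) : Set E2 :=
  {x | x ∈ frontier (P.D α) ∧ ∃ (X : ℝ → E2) (δ : ℝ), 0 < δ ∧ X 0 = x ∧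
    TrajOn P α X (Icc (-δ) 0) ∧ ∀ t ∈ Ioo (-δ) (0:ℝ), X t ∈ P.D α}

/-- Points lying on a Carathéodory trajectory of `g` through some vertex of some `D_α`,
`α ∈ idx`, contained in `⋃_{α ∈ idx} closure Ω_α`:  `⋃_{γ ∈ 𝒯} Im(γ)`. -/
def vertexTrajPoints (P : PolygonalPVF ι) (idx : Set ι) : Set E2 :=
  {z | ∃ (γ : ℝ → E2) (s₀ s₁ : ℝ), s₀ ≤ s₁ ∧ IsCaratheodorySol P.g γ s₀ s₁ ∧
    (∀ t ∈ Icc s₀ s₁, γ t ∈ ⋃ α ∈ idx, closure (P.Ωp α)) ∧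
    (∃ t ∈ Icc s₀ s₁, ∃ α ∈ idx, IsVertexOf (γ t) (P.D α)) ∧
    ∃ t ∈ Icc s₀ s₁, γ t = z}

end PolygonalPVF

/-- A concatenation of classical solutions (CCS) of the patchy ODE on `[0, S]`:
a left-continuous, piecewise smooth map `y`, with right limits `yp`, such that
`t ↦ α*(y t)` is non-decreasing with values `a 0 < a 1 < ⋯ < a (m-1)` attained exactly
on the intervals `]τ k, τ (k+1)]`, on each of which `y` is a classical solution of
`ẏ = g_{a k}(y)`, with jumps joining the boundaries of consecutive domains. -/
structure CCS {ι : Type*} [LinearOrder ι] (P : PolygonalPVF ι) (S : ℝ) where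
  y : ℝ → E2
  yp : ℝ → E2
  m : ℕ
  a : ℕ → ι
  τ : ℕ → ℝ
  mpos : 0 < m
  left_cont : ∀ t ∈ Ioc (0:ℝ) S, Tendsto y (𝓝[<] t) (𝓝 (y t))
  right_lim : ∀ t ∈ Ico (0:ℝ) S, Tendsto y (𝓝[>] t) (𝓝 (yp t))
  init : y 0 = yp 0
  a_mono : ∀ i j, i < j → j < m → a i < a j
  τ_zero : τ 0 = 0
  τ_last : τ m = S
  τ_mono : ∀ i j, i < j → j ≤ m → τ i < τ j
  mem_D : ∀ k < m, ∀ t ∈ Ioc (0:ℝ) S, (y t ∈ P.D (a k) ↔ t ∈ Ioc (τ k) (τ (k+1)))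
  sol : ∀ k < m, ∀ t ∈ Ioo (τ k) (τ (k+1)), HasDerivAt y (P.gp (a k) (y t)) t
  jump_left : ∀ k, 0 < k → k < m → y (τ k) ∈ frontier (P.D (a (k-1)))
  jump_right : ∀ k, 0 < k → k < m → yp (τ k) ∈ frontier (P.D (a k))

/-- The total jump `Δ(y)` of a CCS. -/
def CCS.Δ {ι : Type*} [LinearOrder ι] {P : PolygonalPVF ι} {S : ℝ}
    (c : CCS P S) : ℝ :=
  ∑ k ∈ Finset.Ico 1 c.m, ‖c.yp (c.τ k) - c.y (c.τ k)‖
/-- Grönwall's inequality in integral form, for an integrand that is only assumed integrable. -/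
theorem integral_gronwall {φ : ℝ → ℝ} {K V T : ℝ} (hK : 0 ≤ K) (hV : 0 ≤ V) (hT : 0 ≤ T)
    (hφ : IntervalIntegrable φ volume 0 T) (hφ0 : ∀ t, 0 ≤ φ t)
    (hle : ∀ t ∈ Icc 0 T, φ t ≤ K * (V + ∫ s in (0 : ℝ)..t, φ s)) :
    V + ∫ s in (0 : ℝ)..T, φ s ≤ Real.exp (K * T) * V := by
  have hu : ContinuousOn (fun t => ∫ s in (0 : ℝ)..t, φ s) (Icc 0 T) := by
    have := intervalIntegral.continuousOn_primitive_interval' hφ left_mem_uIcc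
    rwa [uIcc_of_le hT] at this
  set h : ℝ → ℝ := fun t => K * (V + ∫ s in (0 : ℝ)..t, φ s) with hh
  have hc : ContinuousOn h (Icc 0 T) := continuousOn_const.mul (continuousOn_const.add hu)
  have hsub : ∀ t ∈ Icc 0 T, Icc 0 t ⊆ Icc 0 T := fun t ht => Icc_subset_Icc_right ht.2
  have hint : ∀ t ∈ Icc 0 T, IntervalIntegrable h volume 0 t := fun t ht =>
    ContinuousOn.intervalIntegrable_of_Icc ht.1 (hc.mono (hsub t ht))
  have huF : ∀ t ∈ Icc 0 T, ∫ s in (0 : ℝ)..t, φ s ≤ ∫ s in (0 : ℝ)..t, h s := fun t ht => by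
    refine intervalIntegral.integral_mono_on ht.1 (hφ.mono_set ?_) (hint t ht)
      fun s hs => hle s (hsub t ht hs)
    rw [uIcc_of_le ht.1, uIcc_of_le hT]
    exact hsub t ht
  have h0 : ∀ t ∈ Icc 0 T, 0 ≤ h t := fun t ht => (hφ0 t).trans (hle t ht)
  have hF0 : ∀ t ∈ Icc 0 T, 0 ≤ ∫ s in (0 : ℝ)..t, h s := fun t ht =>
    intervalIntegral.integral_nonneg ht.1 fun s hs => h0 s (hsub t ht hs)
  have hFc : ContinuousOn (fun t => V + ∫ s in (0 : ℝ)..t, h s) (Icc 0 T) := by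
    have := intervalIntegral.continuousOn_primitive_interval' (hint T ⟨hT, le_rfl⟩) left_mem_uIcc
    rw [uIcc_of_le hT] at this
    exact continuousOn_const.add this
  have hd : ∀ t ∈ Ico 0 T,
      HasDerivWithinAt (fun t => V + ∫ s in (0 : ℝ)..t, h s) (h t) (Ici t) t := fun t ht => by
    have hmem : Icc 0 T ∈ 𝓝[>] t :=
      mem_of_superset (Ioo_mem_nhdsGT ht.2) fun s hs => ⟨ht.1.trans hs.1.le, hs.2.le⟩
    refine (intervalIntegral.integral_hasDerivWithinAt_right (hint t ⟨ht.1, ht.2.le⟩)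
      (t := Ioi t) ?_ ?_).const_add V
    · exact ⟨Icc 0 T, hmem, hc.aestronglyMeasurable measurableSet_Icc⟩
    · exact ((hc t ⟨ht.1, ht.2.le⟩).mono_of_mem_nhdsWithin hmem)
  have key := norm_le_gronwallBound_of_norm_deriv_right_le (δ := V) (K := K) (ε := 0) hFc hd
    (by simp [abs_of_nonneg hV]) (fun t ht => by
      have ht' : t ∈ Icc 0 T := ⟨ht.1, ht.2.le⟩
      rw [Real.norm_of_nonneg (h0 t ht'), Real.norm_of_nonneg (add_nonneg hV (hF0 t ht')),
        add_zero]
      exact mul_le_mul_of_nonneg_left (add_le_add_right (huF t ht') V) hK) T ⟨hT, le_rfl⟩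
  rw [gronwallBound_ε0, sub_zero, Real.norm_of_nonneg (add_nonneg hV (hF0 T ⟨hT, le_rfl⟩))] at key
  linarith [huF T ⟨hT, le_rfl⟩, mul_comm V (Real.exp (K * T))]

/-- The classical estimate (1.6): for a bounded Lipschitz vector field, the distance
between the unperturbed and the impulsively perturbed solutions grows at most like
`e^{Lt} · Tot.Var.{w}`. -/
theorem stmt18 {E : Type*} [NormedAddCommGroup E] [NormedSpace ℝ E] [MeasurableSpace E]
    (g : E → E) (L : ℝ≥0) (hLip : LipschitzWith L g)
    (M : ℝ) (hbdd : ∀ x : E, ‖g x‖ ≤ M)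
    (x₀ : E) (w x y : ℝ → E)
    (hw : LeftCont w) (hbv : BoundedVariationOn w (Ici 0))
    (hx0 : x 0 = x₀) (hy0 : y 0 = x₀)
    (hx : ∀ T : ℝ, 0 ≤ T → IsCaratheodorySol g x 0 T)
    (hy : ∀ T : ℝ, 0 ≤ T → IsImpulsiveSol g w y 0 T) :
    ∀ t : ℝ, 0 ≤ t → ‖y t - x t‖ ≤ Real.exp ((L : ℝ) * t) * totVar w (Ici 0) := by
  intro T hT
  have hV : ∀ t, 0 ≤ t → ‖w t - w 0‖ ≤ totVar w (Ici 0) := fun t ht => by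
    rw [← dist_eq_norm]
    exact hbv.dist_le ht self_mem_Ici
  have hgx := (hx T hT).integrable T ⟨hT, le_rfl⟩
  have hgy := (hy T hT).integrable T ⟨hT, le_rfl⟩
  have hdiff : ∀ t ∈ Icc 0 T,
      ‖y t - x t‖ ≤ totVar w (Ici 0) + ∫ s in (0 : ℝ)..t, ‖g (y s) - g (x s)‖ := fun t ht => by
    have hsplit : y t - x t = (w t - w 0) + ∫ s in (0 : ℝ)..t, (g (y s) - g (x s)) := by
      rw [intervalIntegral.integral_sub ((hy T hT).integrable t ht) ((hx T hT).integrable t ht),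
        (hy T hT).eqn t ht, (hx T hT).eqn t ht, hx0, hy0]
      abel
    rw [hsplit]
    exact (norm_add_le _ _).trans (add_le_add (hV t ht.1)
      (intervalIntegral.norm_integral_le_integral_norm ht.1))
  refine (hdiff T ⟨hT, le_rfl⟩).trans ?_
  refine integral_gronwall L.coe_nonneg ENNReal.toReal_nonneg hT (hgy.sub hgx).norm
    (fun _ => norm_nonneg _) fun t ht => ?_
  exact (hLip.norm_sub_le _ _).trans (mul_le_mul_of_nonneg_left (hdiff t ht) L.coe_nonneg)
end
end

section
/- Let g be a uniformly non-zero polygonal patchy vector field on ℝ² satisfying condition (C), let T > 0, and let K′ ⊂ ℝ² be a compact set. Then there exists a constant c₄ > 0 such that for every concatenation of classical solutions (CCS) y : [0, 2T] → K′ of ẋ = g(x), one has |y(t) − y(t′)| ≤ c₄ · (|t − t′| + Δ(y)) for all t, t′ ∈ [0, 2T]. -/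
open Set Filter MeasureTheory Metric
open scoped Topology RealInnerProductSpace ENNReal NNReal

noncomputable section

/-- The fields of the finitely many patches meeting a compact set are uniformly bounded there. -/
theorem PatchyVF.exists_bound {E : Type*} [NormedAddCommGroup E] [NormedSpace ℝ E]
    {ι : Type*} [LinearOrder ι] (P : PatchyVF E ι) {K : Set E} (hK : IsCompact K) :
    ∃ M : ℝ, ∀ α, ∀ x ∈ P.Ωp α ∩ K, ‖P.gp α x‖ ≤ M := by
  have hbound : ∀ α, ∃ C : ℝ, ∀ x ∈ P.Ωp α ∩ K, ‖P.gp α x‖ ≤ C := by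
    intro α
    obtain ⟨U, -, hU, hsmooth⟩ := P.patch_smooth α
    obtain ⟨C, hC⟩ := (hK.inter_left isClosed_closure).exists_bound_of_continuousOn
      (hsmooth.continuousOn.mono (inter_subset_left.trans hU))
    exact ⟨C, fun x hx => hC x ⟨subset_closure hx.1, hx.2⟩⟩
  choose C hC using hbound
  obtain ⟨M, hM⟩ := ((P.loc_fin K hK).image C).bddAbove
  exact ⟨M, fun α x hx => (hC α x hx).trans (hM ⟨α, ⟨x, hx⟩, rfl⟩)⟩

namespace CCS

variable {ι : Type*} [LinearOrder ι] {P : PolygonalPVF ι} {S : ℝ} (c : CCS P S)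

theorem τ_le {i j : ℕ} (hij : i ≤ j) (hj : j ≤ c.m) : c.τ i ≤ c.τ j := by
  rcases hij.eq_or_lt with rfl | h
  · exact le_rfl
  · exact (c.τ_mono i j h hj).le

theorem τ_nonneg {k : ℕ} (hk : k ≤ c.m) : 0 ≤ c.τ k :=
  c.τ_zero ▸ c.τ_le k.zero_le hk

theorem τ_le_last {k : ℕ} (hk : k ≤ c.m) : c.τ k ≤ S :=
  (c.τ_le hk le_rfl).trans_eq c.τ_last

/-- The right limit at the initial time is the initial value, so only interior jumps count. -/
theorem norm_jump_zero : ‖c.yp (c.τ 0) - c.y (c.τ 0)‖ = 0 := by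
  rw [c.τ_zero, ← c.init, sub_self, norm_zero]

variable {K : Set E2} {M : ℝ}

/-- On a single classical piece, a CCS is Lipschitz with the bound on the fields. -/
theorem norm_sub_le_of_mem_Ioc (hM : ∀ α, ∀ x ∈ P.Ωp α ∩ K, ‖P.gp α x‖ ≤ M)
    (hy : ∀ t ∈ Icc (0 : ℝ) S, c.y t ∈ K) {k : ℕ} (hk : k < c.m) {s t : ℝ}
    (hs : c.τ k < s) (hst : s ≤ t) (ht : t ≤ c.τ (k + 1)) :
    ‖c.y t - c.y s‖ ≤ M * (t - s) := by
  have h0 := c.τ_nonneg hk.le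
  have h1 := c.τ_le_last (Nat.succ_le_of_lt hk)
  refine norm_image_sub_le_of_norm_deriv_right_le_segment
    (f' := fun x => P.gp (c.a k) (c.y x)) ?_ ?_ ?_ t ⟨hst, le_rfl⟩
  · intro x hx
    rcases (hx.2.trans ht).lt_or_eq with h | h
    · exact (c.sol k hk x ⟨hs.trans_le hx.1, h⟩).continuousAt.continuousWithinAt
    · have hleft : ContinuousWithinAt c.y (Iio x) x :=
        c.left_cont x ⟨by linarith [hx.1], by linarith⟩
      exact (continuousWithinAt_Iio_iff_Iic.1 hleft).mono
        fun z hz => hz.2.trans (ht.trans h.ge)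
  · intro x hx
    exact (c.sol k hk x ⟨hs.trans_le hx.1, hx.2.trans_le ht⟩).hasDerivWithinAt
  · intro x hx
    have hx0 : 0 < x := by linarith [hx.1]
    have hxS : x ≤ S := by linarith [hx.2]
    have hD := (c.mem_D k hk x ⟨hx0, hxS⟩).2 ⟨hs.trans_le hx.1, (hx.2.trans_le ht).le⟩
    exact hM _ _ ⟨hD.1, hy x ⟨hx0.le, hxS⟩⟩

/-- The Lipschitz bound of a classical piece extends to the right limit at its left end. -/
theorem norm_sub_yp_le (hM : ∀ α, ∀ x ∈ P.Ωp α ∩ K, ‖P.gp α x‖ ≤ M)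
    (hy : ∀ t ∈ Icc (0 : ℝ) S, c.y t ∈ K) {k : ℕ} (hk : k < c.m) {t : ℝ}
    (hkt : c.τ k < t) (ht : t ≤ c.τ (k + 1)) :
    ‖c.y t - c.yp (c.τ k)‖ ≤ M * (t - c.τ k) := by
  have hlim := c.right_lim (c.τ k) ⟨c.τ_nonneg hk.le,
    (c.τ_mono k (k + 1) k.lt_succ_self hk).trans_le (c.τ_le_last hk)⟩
  have hid : Tendsto (fun s : ℝ => s) (𝓝[>] (c.τ k)) (𝓝 (c.τ k)) :=
    tendsto_id.mono_left nhdsWithin_le_nhds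
  refine le_of_tendsto_of_tendsto (tendsto_const_nhds.sub hlim).norm
    ((tendsto_const_nhds.sub hid).const_mul M) ?_
  filter_upwards [Ioc_mem_nhdsGT hkt] with s hs
  exact c.norm_sub_le_of_mem_Ioc hM hy hk hs.1 hs.2 ht

theorem norm_sub_le_of_le_τ (hM : ∀ α, ∀ x ∈ P.Ωp α ∩ K, ‖P.gp α x‖ ≤ M)
    (hy : ∀ t ∈ Icc (0 : ℝ) S, c.y t ∈ K) {k : ℕ} (hk : k ≤ c.m) {s t : ℝ}
    (hs : 0 ≤ s) (hst : s ≤ t) (ht : t ≤ c.τ k) :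
    ‖c.y t - c.y s‖ ≤
      M * (t - s) + ∑ i ∈ Finset.Ico 1 k, ‖c.yp (c.τ i) - c.y (c.τ i)‖ := by
  induction k generalizing t with
  | zero =>
    rw [c.τ_zero] at ht
    obtain rfl : s = t := by linarith
    simp
  | succ k ih =>
    have hsum : ∑ i ∈ Finset.Ico 1 (k + 1), ‖c.yp (c.τ i) - c.y (c.τ i)‖ =
        ∑ i ∈ Finset.Ico 1 k, ‖c.yp (c.τ i) - c.y (c.τ i)‖
          + ‖c.yp (c.τ k) - c.y (c.τ k)‖ := by
      rcases k.eq_zero_or_pos with rfl | hpos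
      · simp [c.norm_jump_zero]
      · exact Finset.sum_Ico_succ_top hpos _
    have hjump := norm_nonneg (c.yp (c.τ k) - c.y (c.τ k))
    rcases le_or_gt t (c.τ k) with htk | htk
    · linarith [ih (Nat.le_of_succ_le hk) hst htk]
    rcases le_or_gt s (c.τ k) with hsk | hsk
    · have hbefore := ih (Nat.le_of_succ_le hk) hsk le_rfl
      have hafter := c.norm_sub_yp_le hM hy hk htk ht
      have htri : ‖c.y t - c.y s‖ ≤ ‖c.y t - c.yp (c.τ k)‖
          + ‖c.yp (c.τ k) - c.y (c.τ k)‖ + ‖c.y (c.τ k) - c.y s‖ := by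
        have hsplit : c.y t - c.y s = (c.y t - c.yp (c.τ k))
            + (c.yp (c.τ k) - c.y (c.τ k)) + (c.y (c.τ k) - c.y s) := by abel
        rw [hsplit]
        exact norm_add₃_le
      linarith
    · have hpiece := c.norm_sub_le_of_mem_Ioc hM hy hk hsk hst ht
      have hnonneg : 0 ≤ ∑ i ∈ Finset.Ico 1 (k + 1), ‖c.yp (c.τ i) - c.y (c.τ i)‖ :=
        Finset.sum_nonneg fun _ _ => norm_nonneg _
      linarith

end CCS

/-- The quasi-Lipschitz estimate (3.69) for concatenations of classical solutions:
`|y(t) - y(t')| ≤ c₄ (|t - t'| + Δ(y))`. -/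
theorem stmt19 {ι : Type*} [LinearOrder ι] (P : PolygonalPVF ι)
    (hdom : P.dom = univ)
    (hnz : P.UnifNonzero)
    (hcC : P.ConditionC)
    (T : ℝ) (hT : 0 < T) (K' : Set E2) (hK' : IsCompact K') :
    ∃ c₄ > 0, ∀ c : CCS P (2*T),
      (∀ t ∈ Icc (0:ℝ) (2*T), c.y t ∈ K') →
      ∀ t ∈ Icc (0:ℝ) (2*T), ∀ t' ∈ Icc (0:ℝ) (2*T),
        ‖c.y t - c.y t'‖ ≤ c₄ * (|t - t'| + c.Δ) := by
  obtain ⟨M, hM⟩ := P.exists_bound hK'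
  refine ⟨max M 1, lt_max_of_lt_right one_pos, fun c hy => ?_⟩
  have hΔ : 0 ≤ c.Δ := Finset.sum_nonneg fun _ _ => norm_nonneg _
  have hle : ∀ s t : ℝ, 0 ≤ s → s ≤ t → t ≤ 2 * T →
      ‖c.y t - c.y s‖ ≤ max M 1 * (|t - s| + c.Δ) := by
    intro s t hs hst ht
    have h : ‖c.y t - c.y s‖ ≤ M * (t - s) + c.Δ :=
      c.norm_sub_le_of_le_τ hM hy le_rfl hs hst (c.τ_last.symm ▸ ht)
    have hvel : M * (t - s) ≤ max M 1 * (t - s) :=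
      mul_le_mul_of_nonneg_right (le_max_left _ _) (sub_nonneg.2 hst)
    have hjump : c.Δ ≤ max M 1 * c.Δ := le_mul_of_one_le_left hΔ (le_max_right _ _)
    rw [abs_of_nonneg (sub_nonneg.2 hst)]
    linarith
  intro t ht t' ht'
  rcases le_total t' t with h | h
  · exact hle t' t ht'.1 h ht.2
  · rw [norm_sub_rev, abs_sub_comm]
    exact hle t t' ht.1 h ht'.2
end
end
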